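/- arXiv:2307.13694 — 2 statements merged into one kernel-verified Lean document; each statement's English description precedes it below -/
import Mathlib

section
/- A sequence {A_n} of operators in the unit ball of B(H, K₁⊗K₂) is relatively compact in the strong operator topology if and only if there exists a faithful state σ ∈ S(H) such that both sequences of partial traces { Tr_{K₂}(A_n σ A_n*) } ⊂ T_+(K₁) and { Tr_{K₁}(A_n σ A_n*) } ⊂ T_+(K₂) are relatively compact in the respective trace norms. -/
open Filter Topology ContinuousLinearMap
open scoped ComplexOrder

noncomputable section

notation "⟪" x ", " y "⟫" => @inner ℂ _ _ x y

section Defs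

variable {H K : Type*} [NormedAddCommGroup H] [InnerProductSpace ℂ H] [CompleteSpace H]
  [NormedAddCommGroup K] [InnerProductSpace ℂ K] [CompleteSpace K]

/-- The rank-one operator `|y⟩⟨z|`. -/
def rankOne (y : K) (z : H) : H →L[ℂ] K :=
  (ContinuousLinearMap.toSpanSingleton ℂ y).comp (innerSL ℂ z)

/-- `A` is a trace-class operator (equivalently, nuclear operator). -/
def IsTC (A : H →L[ℂ] K) : Prop :=
  ∃ f : ℕ → K, ∃ g : ℕ → H, Summable (fun n => ‖f n‖ * ‖g n‖) ∧
    ∀ x : H, HasSum (fun n => ⟪g n, x⟫ • f n) (A x)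

/-- The trace of an operator, computed in a Hilbert basis. -/
def trC {ι : Type*} (e : HilbertBasis ι ℂ H) (A : H →L[ℂ] H) : ℂ :=
  ∑' i, ⟪e i, A (e i)⟫

/-- The trace norm `‖A‖₁ = sup {|Tr (B A)| : ‖B‖ ≤ 1}`. -/
def tnorm {ι : Type*} (e : HilbertBasis ι ℂ H) (A : H →L[ℂ] H) : ℝ :=
  sSup { r : ℝ | ∃ B : H →L[ℂ] H, ‖B‖ ≤ 1 ∧ r = ‖trC e (B ∘L A)‖ }

/-- Membership in the positive cone `T₊(H)` of trace-class operators. -/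
def IsPTC (ρ : H →L[ℂ] H) : Prop := ρ.IsPositive ∧ IsTC ρ

/-- `ρ` is a state (a positive trace-class operator of unit trace). -/
def IsState {ι : Type*} (e : HilbertBasis ι ℂ H) (ρ : H →L[ℂ] H) : Prop :=
  ρ.IsPositive ∧ IsTC ρ ∧ trC e ρ = 1

/-- `ρ` is a faithful state (a state with trivial kernel). -/
def IsFaithfulState {ι : Type*} (e : HilbertBasis ι ℂ H) (ρ : H →L[ℂ] H) : Prop :=
  IsState e ρ ∧ ∀ x, ρ x = 0 → x = 0

/-- The Loewner operator order. -/
def OpLE (A B : H →L[ℂ] H) : Prop := (B - A).IsPositive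

/-- `S` is the least upper bound of the sequence `A` in the Loewner order. -/
def IsLUBOp (A : ℕ → H →L[ℂ] H) (S : H →L[ℂ] H) : Prop :=
  (∀ m, OpLE (A m) S) ∧ ∀ C, (∀ m, OpLE (A m) C) → OpLE S C

/-- A quantum operation from `A` to `B`: a completely positive trace-non-increasing
linear map from `T(H_A)` to `T(H_B)`. -/
structure QOp (eA : HilbertBasis ℕ ℂ H) (eB : HilbertBasis ℕ ℂ K) where
  toFun : (H →L[ℂ] H) → (K →L[ℂ] K)
  map_add' : ∀ ρ σ : H →L[ℂ] H, IsTC ρ → IsTC σ → toFun (ρ + σ) = toFun ρ + toFun σ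
  map_smul' : ∀ (c : ℂ) (ρ : H →L[ℂ] H), IsTC ρ → toFun (c • ρ) = c • toFun ρ
  maps_tc' : ∀ ρ : H →L[ℂ] H, IsTC ρ → IsTC (toFun ρ)
  completely_pos' : ∀ (n : ℕ) (y : Fin n → H) (x : Fin n → K),
    0 ≤ ∑ i, ∑ j, ⟪x i, toFun (rankOne (y i) (y j)) (x j)⟫
  trace_nonincreasing' : ∀ ρ : H →L[ℂ] H, ρ.IsPositive → IsTC ρ →
    (trC eB (toFun ρ)).re ≤ (trC eA ρ).re

variable {eA : HilbertBasis ℕ ℂ H} {eB : HilbertBasis ℕ ℂ K}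

/-- A quantum channel is a trace-preserving quantum operation. -/
def IsChannel (Φ : QOp eA eB) : Prop :=
  ∀ ρ : H →L[ℂ] H, ρ.IsPositive → IsTC ρ → trC eB (Φ.toFun ρ) = trC eA ρ

/-- Convergence in the trace norm. -/
def TNConv {ι : Type*} (e : HilbertBasis ι ℂ K) (a : ℕ → K →L[ℂ] K) (L : K →L[ℂ] K) : Prop :=
  Tendsto (fun n => tnorm e (a n - L)) atTop (nhds 0)

/-- Strong convergence of a sequence of quantum operations. -/
def StrongConv (Φn : ℕ → QOp eA eB) (Φ : QOp eA eB) : Prop :=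
  ∀ ρ : H →L[ℂ] H, IsState eA ρ → TNConv eB (fun n => (Φn n).toFun ρ) (Φ.toFun ρ)

/-- Relative (sequential) compactness in the strong convergence topology. -/
def QRelCompact (F : Set (QOp eA eB)) : Prop :=
  ∀ Φs : ℕ → QOp eA eB, (∀ n, Φs n ∈ F) →
    ∃ (k : ℕ → ℕ) (Φ₀ : QOp eA eB), StrictMono k ∧ StrongConv (fun n => Φs (k n)) Φ₀

/-- Relative (sequential) compactness within the set of quantum channels. -/
def QRelCompactCh (F : Set (QOp eA eB)) : Prop :=
  ∀ Φs : ℕ → QOp eA eB, (∀ n, Φs n ∈ F) →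
    ∃ (k : ℕ → ℕ) (Φ₀ : QOp eA eB), StrictMono k ∧ IsChannel Φ₀ ∧
      StrongConv (fun n => Φs (k n)) Φ₀

/-- (Sequential) compactness in the strong convergence topology. -/
def QSeqCompact (F : Set (QOp eA eB)) : Prop :=
  ∀ Φs : ℕ → QOp eA eB, (∀ n, Φs n ∈ F) →
    ∃ (k : ℕ → ℕ) (Φ₀ : QOp eA eB), StrictMono k ∧ Φ₀ ∈ F ∧
      StrongConv (fun n => Φs (k n)) Φ₀

/-- (Sequential) closedness in the strong convergence topology. -/
def QSeqClosed (F : Set (QOp eA eB)) : Prop :=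
  ∀ (Φs : ℕ → QOp eA eB) (Φ₀ : QOp eA eB), (∀ n, Φs n ∈ F) → StrongConv Φs Φ₀ → Φ₀ ∈ F

/-- (Sequential) compactness of a set of operators in the trace norm. -/
def TNSeqCompact {ι : Type*} (e : HilbertBasis ι ℂ K) (S : Set (K →L[ℂ] K)) : Prop :=
  ∀ a : ℕ → K →L[ℂ] K, (∀ n, a n ∈ S) →
    ∃ (k : ℕ → ℕ) (L : K →L[ℂ] K), StrictMono k ∧ L ∈ S ∧ TNConv e (fun n => a (k n)) L

/-- Relative (sequential) compactness of `S` within the ambient set `T`, in the trace norm. -/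
def TNRelCompactIn {ι : Type*} (e : HilbertBasis ι ℂ K) (T S : Set (K →L[ℂ] K)) : Prop :=
  ∀ a : ℕ → K →L[ℂ] K, (∀ n, a n ∈ S) →
    ∃ (k : ℕ → ℕ) (L : K →L[ℂ] K), StrictMono k ∧ L ∈ T ∧ TNConv e (fun n => a (k n)) L

/-- `A` is a Kraus representation of `Φ`. -/
def KrausRep (Φ : QOp eA eB) (A : ℕ → H →L[ℂ] K) : Prop :=
  ∀ ρ : H →L[ℂ] H, IsTC ρ →
    HasSum (fun n => A n ∘L ρ ∘L (ContinuousLinearMap.adjoint (A n))) (Φ.toFun ρ)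

/-- The Choi rank of a quantum operation: the minimal number of Kraus operators. -/
def ChoiRank (Φ : QOp eA eB) : ℕ∞ :=
  sInf { n : ℕ∞ | ∃ A : ℕ → H →L[ℂ] K, (∀ i : ℕ, n ≤ (i : ℕ∞) → A i = 0) ∧ KrausRep Φ A }

/-- Convergence in the strong operator topology. -/
def SOTConv (a : ℕ → H →L[ℂ] K) (A : H →L[ℂ] K) : Prop :=
  ∀ x : H, Tendsto (fun n => a n x) atTop (nhds (A x))

/-- Relative (sequential) compactness in the strong operator topology. -/
def SOTRelCompact (S : Set (H →L[ℂ] K)) : Prop :=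
  ∀ a : ℕ → H →L[ℂ] K, (∀ n, a n ∈ S) →
    ∃ (k : ℕ → ℕ) (A : H →L[ℂ] K), StrictMono k ∧ SOTConv (fun n => a (k n)) A

/-- (Sequential) compactness in the strong operator topology. -/
def SOTSeqCompact (S : Set (H →L[ℂ] K)) : Prop :=
  ∀ a : ℕ → H →L[ℂ] K, (∀ n, a n ∈ S) →
    ∃ (k : ℕ → ℕ) (A : H →L[ℂ] K), StrictMono k ∧ A ∈ S ∧ SOTConv (fun n => a (k n)) A

/-- A finite-rank orthogonal projection. -/
def IsFinRankProj (P : K →L[ℂ] K) : Prop :=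
  IsSelfAdjoint P ∧ P ∘L P = P ∧ FiniteDimensional ℂ (LinearMap.range (P : K →ₗ[ℂ] K))

end Defs

section Tensor

variable {H K W : Type*} [NormedAddCommGroup H] [InnerProductSpace ℂ H] [CompleteSpace H]
  [NormedAddCommGroup K] [InnerProductSpace ℂ K] [CompleteSpace K]
  [NormedAddCommGroup W] [InnerProductSpace ℂ W] [CompleteSpace W]

/-- A realization of `W` as the Hilbert tensor product `H ⊗ K`. -/
structure TensorStruct (H K W : Type*) [NormedAddCommGroup H] [InnerProductSpace ℂ H]
    [NormedAddCommGroup K] [InnerProductSpace ℂ K]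
    [NormedAddCommGroup W] [InnerProductSpace ℂ W] where
  mul : H → K → W
  inner_mul : ∀ (x x' : H) (y y' : K), ⟪mul x y, mul x' y'⟫ = ⟪x, x'⟫ * ⟪y, y'⟫
  dense_span : Dense (↑(Submodule.span ℂ {w : W | ∃ x y, w = mul x y}) : Set W)

/-- `Z = X ⊗ Y` relative to the tensor realization `T`. -/
def IsTensorOp (T : TensorStruct H K W) (X : H →L[ℂ] H) (Y : K →L[ℂ] K)
    (Z : W →L[ℂ] W) : Prop :=
  ∀ x y, Z (T.mul x y) = T.mul (X x) (Y y)

/-- `b = Tr_K ω`, the left partial trace, characterized by duality. -/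
def IsLeftMarginal (T : TensorStruct H K W) {ι κ : Type*} (eH : HilbertBasis ι ℂ H)
    (eW : HilbertBasis κ ℂ W) (ω : W →L[ℂ] W) (b : H →L[ℂ] H) : Prop :=
  ∀ (X : H →L[ℂ] H) (Z : W →L[ℂ] W), IsTensorOp T X 1 Z →
    trC eH (b ∘L X) = trC eW (ω ∘L Z)

/-- `c = Tr_H ω`, the right partial trace, characterized by duality. -/
def IsRightMarginal (T : TensorStruct H K W) {ι κ : Type*} (eK : HilbertBasis ι ℂ K)
    (eW : HilbertBasis κ ℂ W) (ω : W →L[ℂ] W) (c : K →L[ℂ] K) : Prop :=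
  ∀ (Y : K →L[ℂ] K) (Z : W →L[ℂ] W), IsTensorOp T 1 Y Z →
    trC eK (c ∘L Y) = trC eW (ω ∘L Z)

end Tensor

section Nuclear

set_option linter.unusedSectionVars false

variable {H K L : Type*} [NormedAddCommGroup H] [InnerProductSpace ℂ H] [CompleteSpace H]
  [NormedAddCommGroup K] [InnerProductSpace ℂ K] [CompleteSpace K]
  [NormedAddCommGroup L] [InnerProductSpace ℂ L] [CompleteSpace L]
  {ι κ : Type*}

lemma summable_mul_and_tsum_le {a b : ι → ℝ} {p q : ℝ} (ha : ∀ i, 0 ≤ a i) (hb : ∀ i, 0 ≤ b i)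
    (hp : 0 ≤ p) (hq : 0 ≤ q) (hap : ∀ s : Finset ι, ∑ i ∈ s, a i ^ 2 ≤ p ^ 2)
    (hbq : ∀ s : Finset ι, ∑ i ∈ s, b i ^ 2 ≤ q ^ 2) :
    Summable (fun i => a i * b i) ∧ ∑' i, a i * b i ≤ p * q := by
  have key : ∀ s : Finset ι, ∑ i ∈ s, a i * b i ≤ p * q := fun s => by
    refine abs_le_of_sq_le_sq' ?_ (by positivity) |>.2
    calc (∑ i ∈ s, a i * b i) ^ 2 ≤ (∑ i ∈ s, a i ^ 2) * ∑ i ∈ s, b i ^ 2 :=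
          Finset.sum_mul_sq_le_sq_mul_sq _ _ _
      _ ≤ p ^ 2 * q ^ 2 := mul_le_mul (hap s) (hbq s)
          (Finset.sum_nonneg fun _ _ => sq_nonneg _) (sq_nonneg _)
      _ = (p * q) ^ 2 := by ring
  exact ⟨summable_of_sum_le (fun i => mul_nonneg (ha i) (hb i)) key,
    Real.tsum_le_of_sum_le (fun i => mul_nonneg (ha i) (hb i)) key⟩

lemma summable_prod_of_tsum_le {F : κ × ι → ℝ} {c : κ → ℝ} (hF : ∀ p, 0 ≤ F p)
    (h1 : ∀ k, Summable fun i => F (k, i)) (h2 : ∀ k, ∑' i, F (k, i) ≤ c k) (hc : Summable c) :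
    Summable F ∧ ∑' p, F p ≤ ∑' k, c k := by
  have h3 : Summable fun k => ∑' i, F (k, i) :=
    hc.of_nonneg_of_le (fun k => tsum_nonneg fun i => hF _) h2
  have h4 : Summable F := (summable_prod_of_nonneg hF).2 ⟨h1, h3⟩
  exact ⟨h4, h4.tsum_prod.trans_le (h3.tsum_le_tsum h2 hc)⟩

/-- `A = ∑ |f i⟩⟨g i|` with an absolutely convergent sum. -/
structure NucRep (A : H →L[ℂ] K) (f : ι → K) (g : ι → H) : Prop where
  summable : Summable fun i => ‖f i‖ * ‖g i‖
  hasSum : ∀ x, HasSum (fun i => ⟪g i, x⟫ • f i) (A x)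

lemma norm_rankOne_le (y : K) (z : H) : ‖rankOne y z‖ ≤ ‖y‖ * ‖z‖ := by
  refine ContinuousLinearMap.opNorm_le_bound _ (by positivity) fun x => ?_
  have : rankOne y z x = ⟪z, x⟫ • y := rfl
  rw [this, norm_smul]
  nlinarith [norm_inner_le_norm (𝕜 := ℂ) z x, norm_nonneg y]

lemma exists_nucRep {f : ι → K} {g : ι → H} (h : Summable fun i => ‖f i‖ * ‖g i‖) :
    ∃ A : H →L[ℂ] K, NucRep A f g := by
  have hs : Summable fun i => rankOne (f i) (g i) :=
    Summable.of_norm_bounded h fun i => norm_rankOne_le _ _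
  exact ⟨∑' i, rankOne (f i) (g i), h, fun x =>
    hs.hasSum.mapL (ContinuousLinearMap.apply ℂ K x)⟩

namespace NucRep

variable {A A' : H →L[ℂ] K} {f f' : ι → K} {g g' : ι → H}

lemma reindex (h : NucRep A f g) (e : κ ≃ ι) : NucRep A (f ∘ e) (g ∘ e) :=
  ⟨(e.summable_iff (f := fun i => ‖f i‖ * ‖g i‖)).2 h.summable,
    fun x => (e.hasSum_iff (f := fun i => ⟪g i, x⟫ • f i)).2 (h.hasSum x)⟩

lemma isTC [Denumerable ι] (h : NucRep A f g) : IsTC A :=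
  let h' := h.reindex (Denumerable.eqv ι).symm
  ⟨_, _, h'.summable, h'.hasSum⟩

lemma comp_left (h : NucRep A f g) (B : K →L[ℂ] L) : NucRep (B ∘L A) (fun i => B (f i)) g where
  summable := (h.summable.mul_left ‖B‖).of_nonneg_of_le (fun i => by positivity) fun i => by
    rw [← mul_assoc]
    exact mul_le_mul_of_nonneg_right (B.le_opNorm _) (norm_nonneg _)
  hasSum x := by simpa using (h.hasSum x).mapL B

lemma comp_right (h : NucRep A f g) (B : L →L[ℂ] H) :
    NucRep (A ∘L B) f (fun i => adjoint B (g i)) where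
  summable := (h.summable.mul_left ‖adjoint B‖).of_nonneg_of_le (fun i => by positivity) fun i => by
    rw [mul_left_comm]
    exact mul_le_mul_of_nonneg_left ((adjoint B).le_opNorm _) (norm_nonneg _)
  hasSum x := by simpa [ContinuousLinearMap.adjoint_inner_left] using h.hasSum (B x)

lemma summable_inner {A : H →L[ℂ] H} {f : ι → H} (h : NucRep A f g) :
    Summable fun i => ⟪g i, f i⟫ :=
  Summable.of_norm_bounded h.summable fun _ => (norm_inner_le_norm _ _).trans_eq (mul_comm _ _)

lemma norm_tsum_inner_le {A : H →L[ℂ] H} {f : ι → H} (h : NucRep A f g) :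
    ‖∑' i, ⟪g i, f i⟫‖ ≤ ∑' i, ‖f i‖ * ‖g i‖ :=
  tsum_of_norm_bounded h.summable.hasSum
    fun _ => (norm_inner_le_norm _ _).trans_eq (mul_comm _ _)

/-- The trace does not depend on the basis. -/
lemma hasSum_trace {A : H →L[ℂ] H} {f : ι → H} (h : NucRep A f g) (e : HilbertBasis κ ℂ H) :
    HasSum (fun k => ⟪e k, A (e k)⟫) (∑' i, ⟪g i, f i⟫) := by
  have hcs : ∀ i, Summable (fun k => ‖⟪g i, e k⟫‖ * ‖⟪e k, f i⟫‖) ∧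
      ∑' k, ‖⟪g i, e k⟫‖ * ‖⟪e k, f i⟫‖ ≤ ‖g i‖ * ‖f i‖ := fun i =>
    summable_mul_and_tsum_le (fun _ => norm_nonneg _) (fun _ => norm_nonneg _) (norm_nonneg _)
      (norm_nonneg _)
      (fun s => by
        simpa only [norm_inner_symm (g i)] using e.orthonormal.sum_inner_products_le (g i))
      (fun s => e.orthonormal.sum_inner_products_le _)
  have hF : Summable (fun p : ι × κ => ⟪g p.1, e p.2⟫ * ⟪e p.2, f p.1⟫) := by
    refine Summable.of_norm ?_
    simp only [norm_mul]
    exact (summable_prod_of_tsum_le (fun p => by positivity) (fun i => (hcs i).1)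
      (fun i => (hcs i).2) (by simpa only [mul_comm] using h.summable)).1
  have h1 := hF.hasSum.prod_fiberwise fun i => e.hasSum_inner_mul_inner (g i) (f i)
  rw [h1.tsum_eq]
  refine ((Equiv.prodComm κ ι).hasSum_iff.2 hF.hasSum).prod_fiberwise fun k => ?_
  simpa [Function.comp_def, inner_smul_right] using
    (h.hasSum (e k)).mapL (innerSL ℂ (e k))

lemma trC_eq {A : H →L[ℂ] H} {f : ι → H} (h : NucRep A f g) (e : HilbertBasis κ ℂ H) :
    trC e A = ∑' i, ⟪g i, f i⟫ := (h.hasSum_trace e).tsum_eq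

lemma norm_trC_comp_le {A : H →L[ℂ] H} {f : ι → H} (h : NucRep A f g) (e : HilbertBasis κ ℂ H)
    {B : H →L[ℂ] H} (hB : ‖B‖ ≤ 1) : ‖trC e (B ∘L A)‖ ≤ ∑' i, ‖f i‖ * ‖g i‖ := by
  rw [(h.comp_left B).trC_eq]
  refine (h.comp_left B).norm_tsum_inner_le.trans
    ((h.comp_left B).summable.tsum_le_tsum (fun i => ?_) h.summable)
  exact mul_le_mul_of_nonneg_right ((B.le_of_opNorm_le hB _).trans_eq (one_mul _)) (norm_nonneg _)

lemma trC_add {A A' : H →L[ℂ] H} {f : ι → H} {κ' : Type*} {f' g' : κ' → H} (h : NucRep A f g)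
    (h' : NucRep A' f' g') (e : HilbertBasis κ ℂ H) : trC e (A + A') = trC e A + trC e A' := by
  rw [h.trC_eq, h'.trC_eq]
  refine HasSum.tsum_eq ?_
  simpa [inner_add_right] using (h.hasSum_trace e).add (h'.hasSum_trace e)

lemma tnorm_add_le {A A' : H →L[ℂ] H} {f : ι → H} {κ' : Type*} {f' g' : κ' → H} (h : NucRep A f g)
    (h' : NucRep A' f' g') (e : HilbertBasis κ ℂ H) :
    tnorm e (A + A') ≤ ∑' i, ‖f i‖ * ‖g i‖ + ∑' i, ‖f' i‖ * ‖g' i‖ := by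
  refine Real.sSup_le ?_ (by positivity)
  rintro r ⟨B, hB, rfl⟩
  rw [ContinuousLinearMap.comp_add, (h.comp_left B).trC_add (h'.comp_left B)]
  exact (norm_add_le _ _).trans (add_le_add (h.norm_trC_comp_le e hB) (h'.norm_trC_comp_le e hB))

lemma sub {A A' : H →L[ℂ] K} {f : ι → K} (h : NucRep A f g) {f' : κ → K} {g' : κ → H}
    (h' : NucRep A' f' g') :
    NucRep (A - A') (Sum.elim f (fun i => -f' i)) (Sum.elim g g') where
  summable := by
    refine (HasSum.sum (f := fun i => ‖Sum.elim f (fun i => -f' i) i‖ * ‖Sum.elim g g' i‖)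
      (a := ∑' i, ‖f i‖ * ‖g i‖) (b := ∑' i, ‖f' i‖ * ‖g' i‖) ?_ ?_).summable
    · simpa [Function.comp_def] using h.summable.hasSum
    · simpa [Function.comp_def] using h'.summable.hasSum
  hasSum x := by
    rw [sub_apply, sub_eq_add_neg]
    refine HasSum.sum (f := fun i => ⟪Sum.elim g g' i, x⟫ • Sum.elim f (fun i => -f' i) i) ?_ ?_
    · simpa [Function.comp_def] using h.hasSum x
    · simpa [Function.comp_def] using (h'.hasSum x).neg

lemma norm_trC_comp_le_tnorm {A : H →L[ℂ] H} {f : ι → H} (h : NucRep A f g)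
    (e : HilbertBasis κ ℂ H) {B : H →L[ℂ] H} (hB : ‖B‖ ≤ 1) :
    ‖trC e (B ∘L A)‖ ≤ tnorm e A := by
  refine le_csSup ⟨∑' i, ‖f i‖ * ‖g i‖, ?_⟩ ⟨B, hB, rfl⟩
  rintro r ⟨B, hB, rfl⟩
  exact h.norm_trC_comp_le e hB

lemma isPositive {A : H →L[ℂ] H} {w : ι → ℝ} (hw : ∀ i, 0 ≤ w i)
    (h : NucRep A (fun i => (w i : ℂ) • g i) g) : A.IsPositive := by
  rw [ContinuousLinearMap.isPositive_iff_complex]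
  intro x
  have h1 : HasSum (fun i => ((w i * ‖⟪g i, x⟫‖ ^ 2 : ℝ) : ℂ)) ⟪x, A x⟫ := by
    refine ((h.hasSum x).mapL (innerSL ℂ x)).congr_fun fun i => ?_
    rw [innerSL_apply_apply, inner_smul_right, inner_smul_right, mul_left_comm,
      ← inner_conj_symm x (g i), Complex.mul_conj, Complex.normSq_eq_norm_sq]
    push_cast
    rfl
  have h2 : ⟪A x, x⟫ = ((∑' i, w i * ‖⟪g i, x⟫‖ ^ 2 : ℝ) : ℂ) := by
    rw [← inner_conj_symm, ← h1.tsum_eq, ← Complex.ofReal_tsum, Complex.conj_ofReal]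
  rw [h2]
  exact ⟨by simp, by simpa using tsum_nonneg fun i => mul_nonneg (hw i) (sq_nonneg _)⟩

end NucRep

lemma tnorm_nonneg (e : HilbertBasis κ ℂ H) (A : H →L[ℂ] H) : 0 ≤ tnorm e A := by
  refine Real.sSup_nonneg ?_
  rintro r ⟨B, -, rfl⟩
  exact norm_nonneg _

lemma IsTC.exists_nucRep {A : H →L[ℂ] K} (h : IsTC A) :
    ∃ (f : ℕ → K) (g : ℕ → H), NucRep A f g :=
  let ⟨f, g, h1, h2⟩ := h
  ⟨f, g, h1, h2⟩

end Nuclear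

section TensorSlices

set_option linter.unusedSectionVars false

variable {H K1 K2 W : Type*}
  [NormedAddCommGroup H] [InnerProductSpace ℂ H] [CompleteSpace H]
  [NormedAddCommGroup K1] [InnerProductSpace ℂ K1] [CompleteSpace K1]
  [NormedAddCommGroup K2] [InnerProductSpace ℂ K2] [CompleteSpace K2]
  [NormedAddCommGroup W] [InnerProductSpace ℂ W] [CompleteSpace W]
  {ι κ τ : Type*}

namespace TensorStruct

lemma ext_inner (T : TensorStruct K1 K2 W) {w w' : W}
    (h : ∀ x y, ⟪T.mul x y, w⟫ = ⟪T.mul x y, w'⟫) : w = w' := by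
  rw [← sub_eq_zero]
  refine T.dense_span.eq_zero_of_inner_right ℂ fun v hv => ?_
  induction hv using Submodule.span_induction with
  | mem v hv => obtain ⟨x, y, rfl⟩ := hv; rw [inner_sub_right, h, sub_self]
  | zero => simp
  | add a b _ _ ha hb => rw [inner_add_left, ha, hb, add_zero]
  | smul c a _ ha => rw [inner_smul_left, ha, mul_zero]

/-- The flipped realization of the tensor product. -/
def swap (T : TensorStruct K1 K2 W) : TensorStruct K2 K1 W where
  mul y x := T.mul x y
  inner_mul x x' y y' := by rw [T.inner_mul, mul_comm]
  dense_span := by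
    convert T.dense_span using 4
    ext w
    exact exists_comm

@[simp] lemma swap_mul (T : TensorStruct K1 K2 W) (x : K1) (y : K2) :
    T.swap.mul y x = T.mul x y := rfl

lemma norm_mul (T : TensorStruct K1 K2 W) (x : K1) (y : K2) : ‖T.mul x y‖ = ‖x‖ * ‖y‖ := by
  have h := T.inner_mul x x y y
  simp only [inner_self_eq_norm_sq_to_K] at h
  rw [← sq_eq_sq₀ (norm_nonneg _) (by positivity), mul_pow]
  exact_mod_cast h

/-- The operator `x ↦ x ⊗ y`. -/
def right (T : TensorStruct K1 K2 W) (y : K2) : K1 →L[ℂ] W :=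
  LinearMap.mkContinuous
    { toFun := fun x => T.mul x y
      map_add' := fun x x' => T.ext_inner fun a b => by
        simp only [inner_add_right, T.inner_mul, add_mul]
      map_smul' := fun c x => T.ext_inner fun a b => by
        simp only [inner_smul_right, T.inner_mul, RingHom.id_apply, mul_assoc] }
    ‖y‖ fun x => by simp [T.norm_mul, mul_comm]

@[simp] lemma right_apply (T : TensorStruct K1 K2 W) (x : K1) (y : K2) :
    T.right y x = T.mul x y := rfl

/-- The operator `I ⊗ ⟨y|`. -/
def slice (T : TensorStruct K1 K2 W) (y : K2) : W →L[ℂ] K1 := adjoint (T.right y)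

lemma inner_slice_right (T : TensorStruct K1 K2 W) (x : K1) (y : K2) (w : W) :
    ⟪x, T.slice y w⟫ = ⟪T.mul x y, w⟫ := by
  rw [slice, ContinuousLinearMap.adjoint_inner_right, right_apply]

lemma inner_slice_left (T : TensorStruct K1 K2 W) (x : K1) (y : K2) (w : W) :
    ⟪T.slice y w, x⟫ = ⟪w, T.mul x y⟫ := by
  rw [slice, ContinuousLinearMap.adjoint_inner_left, right_apply]

lemma slice_mul (T : TensorStruct K1 K2 W) (y : K2) (x : K1) (y' : K2) :
    T.slice y (T.mul x y') = ⟪y, y'⟫ • x :=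
  ext_inner_left ℂ fun z => by
    rw [inner_slice_right, T.inner_mul, inner_smul_right, mul_comm]

lemma orthonormal_mul (T : TensorStruct K1 K2 W) {e1 : ι → K1} {e2 : κ → K2}
    (h1 : Orthonormal ℂ e1) (h2 : Orthonormal ℂ e2) :
    Orthonormal ℂ fun p : ι × κ => T.mul (e1 p.1) (e2 p.2) := by
  classical
  rw [orthonormal_iff_ite] at *
  rintro ⟨i, j⟩ ⟨i', j'⟩
  simp only [T.inner_mul, h1, h2, Prod.mk.injEq]
  split_ifs <;> simp_all

/-- The product Hilbert basis. -/
def basis (T : TensorStruct K1 K2 W) (e1 : HilbertBasis ι ℂ K1) (e2 : HilbertBasis κ ℂ K2) :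
    HilbertBasis (ι × κ) ℂ W :=
  HilbertBasis.mkOfOrthogonalEqBot (T.orthonormal_mul e1.orthonormal e2.orthonormal) <| by
    rw [Submodule.eq_bot_iff]
    intro w hw
    have h0 : ∀ i j, ⟪T.mul (e1 i) (e2 j), w⟫ = 0 := fun i j =>
      hw _ (Submodule.subset_span ⟨(i, j), rfl⟩)
    have h1 : ∀ x j, ⟪T.mul x (e2 j), w⟫ = 0 := fun x j => by
      rw [← T.inner_slice_right, ← e1.tsum_inner_mul_inner]
      simp [T.inner_slice_right, h0]
    refine T.ext_inner fun x y => ?_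
    rw [← T.swap_mul, ← T.swap.inner_slice_right, ← e2.tsum_inner_mul_inner]
    simp [T.swap.inner_slice_right, h1]

@[simp] lemma basis_apply (T : TensorStruct K1 K2 W) (e1 : HilbertBasis ι ℂ K1)
    (e2 : HilbertBasis κ ℂ K2) (p : ι × κ) : T.basis e1 e2 p = T.mul (e1 p.1) (e2 p.2) := by
  simp [basis]

lemma hasSum_inner_slice (T : TensorStruct K1 K2 W) (e1 : HilbertBasis ι ℂ K1)
    (e2 : HilbertBasis κ ℂ K2) (u v : W) :
    HasSum (fun j => ⟪T.slice (e2 j) u, T.slice (e2 j) v⟫) ⟪u, v⟫ := by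
  have h := (Equiv.prodComm κ ι).hasSum_iff.2 ((T.basis e1 e2).hasSum_inner_mul_inner u v)
  refine h.prod_fiberwise fun j => ?_
  convert e1.hasSum_inner_mul_inner (T.slice (e2 j) u) (T.slice (e2 j) v) using 2 with i
  simp [T.inner_slice_right, T.inner_slice_left]

lemma sum_norm_slice_sq_le (T : TensorStruct K1 K2 W) (e1 : HilbertBasis ι ℂ K1)
    (e2 : HilbertBasis κ ℂ K2) (u : W) (s : Finset κ) :
    ∑ j ∈ s, ‖T.slice (e2 j) u‖ ^ 2 ≤ ‖u‖ ^ 2 := by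
  have h := T.hasSum_inner_slice e1 e2 u u
  have hsq : HasSum (fun j => ‖T.slice (e2 j) u‖ ^ 2) (‖u‖ ^ 2) := by
    simp only [inner_self_eq_norm_sq_to_K] at h
    exact_mod_cast h
  exact sum_le_hasSum s (fun _ _ => sq_nonneg _) hsq

/-- Slicing both factors along a basis does not increase the nuclear sum. -/
lemma summable_slice (T : TensorStruct K1 K2 W) (e1 : HilbertBasis ι ℂ K1)
    (e2 : HilbertBasis κ ℂ K2) {u v : τ → W} (h : Summable fun k => ‖u k‖ * ‖v k‖) :
    Summable (fun p : τ × κ => ‖T.slice (e2 p.2) (u p.1)‖ * ‖T.slice (e2 p.2) (v p.1)‖) ∧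
      ∑' p : τ × κ, ‖T.slice (e2 p.2) (u p.1)‖ * ‖T.slice (e2 p.2) (v p.1)‖ ≤
        ∑' k, ‖u k‖ * ‖v k‖ := by
  have hcs := fun k => summable_mul_and_tsum_le (a := fun j => ‖T.slice (e2 j) (u k)‖)
    (b := fun j => ‖T.slice (e2 j) (v k)‖) (fun _ => norm_nonneg _) (fun _ => norm_nonneg _)
    (norm_nonneg _) (norm_nonneg _) (T.sum_norm_slice_sq_le e1 e2 (u k))
    (T.sum_norm_slice_sq_le e1 e2 (v k))
  exact summable_prod_of_tsum_le (fun p => by positivity) (fun k => (hcs k).1)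
    (fun k => (hcs k).2) h

lemma slice_comp_of_isTensorOp (T : TensorStruct K1 K2 W) {X : K1 →L[ℂ] K1} {Z : W →L[ℂ] W}
    (h : IsTensorOp T X 1 Z) (y : K2) (w : W) : T.slice y (Z w) = X (T.slice y w) := by
  have : (T.slice y ∘L Z) = X ∘L T.slice y := by
    refine ContinuousLinearMap.ext_on T.dense_span ?_
    rintro _ ⟨x, y', rfl⟩
    simp [h x y', T.slice_mul]
  exact DFunLike.congr_fun this w

end TensorStruct

lemma isLeftMarginal_swap {T : TensorStruct K1 K2 W} {e2 : HilbertBasis ι ℂ K2}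
    {eW : HilbertBasis κ ℂ W} {ω : W →L[ℂ] W} {c : K2 →L[ℂ] K2} :
    IsLeftMarginal T.swap e2 eW ω c ↔ IsRightMarginal T e2 eW ω c :=
  forall_congr' fun _ => forall_congr' fun _ =>
    imp_congr_left ⟨fun h x y => h y x, fun h x y => h y x⟩

lemma NucRep.isLeftMarginal (T : TensorStruct K1 K2 W) (e1 : HilbertBasis ι ℂ K1)
    (e2 : HilbertBasis κ ℂ K2) {κ' : Type*} (eW : HilbertBasis κ' ℂ W) {ω : W →L[ℂ] W}
    {u v : τ → W} (hω : NucRep ω u v) {b : K1 →L[ℂ] K1}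
    (hb : NucRep b (fun p : τ × κ => T.slice (e2 p.2) (u p.1))
      (fun p : τ × κ => T.slice (e2 p.2) (v p.1))) : IsLeftMarginal T e1 eW ω b := by
  intro X Z hZ
  rw [(hb.comp_right X).trC_eq, (hω.comp_right Z).trC_eq]
  refine ((hb.comp_right X).summable_inner.hasSum.prod_fiberwise fun k => ?_).tsum_eq.symm
  simp only [ContinuousLinearMap.adjoint_inner_left, ← T.slice_comp_of_isTensorOp hZ]
  exact T.hasSum_inner_slice e1 e2 _ _

lemma IsLeftMarginal.unique {T : TensorStruct K1 K2 W} {e1 : HilbertBasis ι ℂ K1}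
    {eW : HilbertBasis κ ℂ W} {ω : W →L[ℂ] W} {b b' : K1 →L[ℂ] K1}
    (h : IsLeftMarginal T e1 eW ω b) (h' : IsLeftMarginal T e1 eW ω b') : b = b' := by
  have key : ∀ y z : K1, ∀ a : K1 →L[ℂ] K1, trC e1 (a ∘L rankOne y z) = ⟪z, a y⟫ := by
    intro y z a
    have : NucRep (a ∘L rankOne y z) (fun _ : Unit => a y) (fun _ => z) :=
      ⟨Summable.of_finite, fun x => by
        simp [rankOne, hasSum_unique]⟩
    simp [this.trC_eq]
  ext y
  refine ext_inner_left ℂ fun z => ?_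
  have hZ : IsTensorOp T (rankOne y z) 1
      (T.swap.right y ∘L T.swap.slice z) := by
    intro x k
    have : T.swap.slice z (T.mul x k) = ⟪z, x⟫ • k := T.swap.slice_mul z k x
    rw [ContinuousLinearMap.comp_apply, this, map_smul]
    change _ = T.right k (⟪z, x⟫ • y)
    rw [map_smul]
    rfl
  rw [← key, ← key, h _ _ hZ, h' _ _ hZ]

end TensorSlices

section Forward

set_option linter.unusedSectionVars false

variable {H K1 K2 W : Type*}
  [NormedAddCommGroup H] [InnerProductSpace ℂ H] [CompleteSpace H]
  [NormedAddCommGroup K1] [InnerProductSpace ℂ K1] [CompleteSpace K1]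
  [NormedAddCommGroup K2] [InnerProductSpace ℂ K2] [CompleteSpace K2]
  [NormedAddCommGroup W] [InnerProductSpace ℂ W] [CompleteSpace W]
  {ι κ τ : Type*}

/-- A diagonal faithful state. -/
lemma exists_isFaithfulState (e : HilbertBasis ℕ ℂ H) :
    ∃ (w : ℕ → ℝ) (σ : H →L[ℂ] H), (∀ k, 0 ≤ w k) ∧ Summable w ∧
      NucRep σ (fun k => (w k : ℂ) • e k) e ∧ IsFaithfulState e σ := by
  have hw := hasSum_geometric_two' 1
  set w : ℕ → ℝ := fun k => 1 / 2 / 2 ^ k with hwdef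
  have hpos : ∀ k, 0 < w k := fun k => by positivity
  have hs : Summable fun k => ‖(w k : ℂ) • e k‖ * ‖e k‖ := by
    simpa [norm_smul, e.orthonormal.norm_eq_one, abs_of_pos (hpos _)] using hw.summable
  obtain ⟨σ, hσ⟩ := exists_nucRep hs
  refine ⟨w, σ, fun k => (hpos k).le, hw.summable, hσ,
    ⟨hσ.isPositive fun k => (hpos k).le, hσ.isTC, ?_⟩, fun x hx => ?_⟩
  · rw [hσ.trC_eq]
    simp only [inner_smul_right, inner_self_eq_norm_sq_to_K, e.orthonormal.norm_eq_one]
    simp only [RCLike.ofReal_one, one_pow, mul_one]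
    rw [← Complex.ofReal_tsum, hw.tsum_eq, Complex.ofReal_one]
  · have h0 : ∀ k, ⟪e k, x⟫ = 0 := fun k => by
      have h1 := (hσ.hasSum x).mapL (innerSL ℂ (e k))
      have h2 := h1.unique (hasSum_single k fun i hi => by
        simp [e.orthonormal.inner_eq_zero hi.symm])
      simpa [hx, inner_smul_right, inner_self_eq_norm_sq_to_K, e.orthonormal.norm_eq_one,
        (hpos k).ne'] using h2
    refine ext_inner_left ℂ fun y => ?_
    rw [← e.tsum_inner_mul_inner]
    simp [h0]

lemma tnorm_sub_le_of_slices (T : TensorStruct K1 K2 W) (e1 : HilbertBasis ι ℂ K1)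
    (e2 : HilbertBasis κ ℂ K2) {u v u' v' : τ → W} {b b' : K1 →L[ℂ] K1}
    (hb : NucRep b (fun p : τ × κ => T.slice (e2 p.2) (u p.1))
      (fun p : τ × κ => T.slice (e2 p.2) (v p.1)))
    (hb' : NucRep b' (fun p : τ × κ => T.slice (e2 p.2) (u' p.1))
      (fun p : τ × κ => T.slice (e2 p.2) (v' p.1)))
    (h : Summable fun k => ‖u k - u' k‖ * ‖v k‖) (h' : Summable fun k => ‖u' k‖ * ‖v k - v' k‖) :
    tnorm e1 (b - b') ≤ ∑' k, ‖u k - u' k‖ * ‖v k‖ + ∑' k, ‖u' k‖ * ‖v k - v' k‖ := by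
  obtain ⟨hs, hle⟩ := T.summable_slice e1 e2 h
  obtain ⟨hs', hle'⟩ := T.summable_slice e1 e2 h'
  obtain ⟨D, hD⟩ := exists_nucRep hs
  obtain ⟨D', hD'⟩ := exists_nucRep hs'
  have : b - b' = D + D' := by
    ext x
    refine ((hb.hasSum x).sub (hb'.hasSum x)).unique ?_
    refine ((hD.hasSum x).add (hD'.hasSum x)).congr_fun fun p => ?_
    simp only [map_sub, smul_sub, inner_sub_left, sub_smul]
    abel
  rw [this]
  exact (hD.tnorm_add_le hD' e1).trans (add_le_add hle hle')

lemma SOTRelCompact.tnRelCompactIn (T : TensorStruct K1 K2 W) (e1 : HilbertBasis ℕ ℂ K1)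
    (e2 : HilbertBasis ℕ ℂ K2) (e : HilbertBasis ℕ ℂ H) {A : ℕ → H →L[ℂ] W}
    (hA : ∀ n, ‖A n‖ ≤ 1) (h : SOTRelCompact {B | ∃ n, B = A n}) {w : ℕ → ℝ}
    (hw0 : ∀ k, 0 ≤ w k) (hw : Summable w) {b : ℕ → K1 →L[ℂ] K1}
    (hb : ∀ n, NucRep (b n) (fun p : ℕ × ℕ => T.slice (e2 p.2) (A n ((w p.1 : ℂ) • e p.1)))
      (fun p : ℕ × ℕ => T.slice (e2 p.2) (A n (e p.1)))) :
    TNRelCompactIn e1 {ρ | IsPTC ρ} {x | ∃ n, x = b n} := by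
  intro a ha
  choose N hN using ha
  obtain ⟨k, A₀, hk, hconv⟩ := h (fun n => A (N n)) fun n => ⟨N n, rfl⟩
  have hbd : ∀ n i, ‖A n (e i)‖ ≤ 1 := fun n i => by
    simpa [e.orthonormal.norm_eq_one] using (A n).le_of_opNorm_le (hA n) (e i)
  have hbd₀ : ∀ i, ‖A₀ (e i)‖ ≤ 1 := fun i =>
    le_of_tendsto (hconv (e i)).norm (Eventually.of_forall fun n => hbd _ i)
  have hdiff : ∀ n i, ‖(A (N (k n)) - A₀) (e i)‖ ≤ 2 := fun n i => by
    rw [sub_apply]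
    exact (norm_sub_le _ _).trans (by linarith [hbd (N (k n)) i, hbd₀ i])
  have hnw : ∀ (B : H →L[ℂ] W) i, ‖B ((w i : ℂ) • e i)‖ = w i * ‖B (e i)‖ := fun B i => by
    rw [map_smul, norm_smul, Complex.norm_real, Real.norm_of_nonneg (hw0 i)]
  have hs₀ : Summable fun i => ‖A₀ ((w i : ℂ) • e i)‖ * ‖A₀ (e i)‖ := by
    refine hw.of_nonneg_of_le (fun i => by positivity) fun i => ?_
    rw [hnw, mul_assoc]
    exact mul_le_of_le_one_right (hw0 i) (mul_le_one₀ (hbd₀ i) (norm_nonneg _) (hbd₀ i))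
  obtain ⟨b₀, hb₀⟩ := exists_nucRep (T.summable_slice e1 e2 hs₀).1
  have hlim : Tendsto (fun n => ∑' i, w i * ‖(A (N (k n)) - A₀) (e i)‖) atTop (𝓝 0) := by
    have := tendsto_tsum_of_dominated_convergence (𝓕 := atTop)
      (f := fun n i => w i * ‖(A (N (k n)) - A₀) (e i)‖) (g := fun _ => (0 : ℝ))
      (bound := fun i => w i * 2) (hw.mul_right 2)
      (fun i => by
        have h1 := ((hconv (e i)).sub_const (A₀ (e i))).norm.const_mul (w i)
        simpa using h1)
      (Eventually.of_forall fun n i => by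
        rw [Real.norm_of_nonneg (mul_nonneg (hw0 i) (norm_nonneg _))]
        exact mul_le_mul_of_nonneg_left (hdiff n i) (hw0 i))
    simpa using this
  refine ⟨k, b₀, hk, ⟨?_, hb₀.isTC⟩, squeeze_zero
    (g := fun n => ∑' i, w i * ‖(A (N (k n)) - A₀) (e i)‖ +
      ∑' i, w i * ‖(A (N (k n)) - A₀) (e i)‖)
    (fun n => tnorm_nonneg _ _) (fun n => ?_)
    (by simpa using hlim.add hlim)⟩
  · refine NucRep.isPositive (w := fun p : ℕ × ℕ => w p.1)
      (g := fun p : ℕ × ℕ => T.slice (e2 p.2) (A₀ (e p.1))) (fun p => hw0 _) ?_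
    simpa only [map_smul] using hb₀
  · have hsd : Summable fun i => w i * ‖(A (N (k n)) - A₀) (e i)‖ := by
      refine (hw.mul_right 2).of_nonneg_of_le
        (fun i => mul_nonneg (hw0 i) (norm_nonneg _)) fun i => ?_
      exact mul_le_mul_of_nonneg_left (hdiff n i) (hw0 i)
    have hle1 : ∀ i, ‖A (N (k n)) ((w i : ℂ) • e i) - A₀ ((w i : ℂ) • e i)‖ *
        ‖A (N (k n)) (e i)‖ ≤ w i * ‖(A (N (k n)) - A₀) (e i)‖ := fun i => by
      rw [← sub_apply, hnw]
      exact mul_le_of_le_one_right (mul_nonneg (hw0 i) (norm_nonneg _)) (hbd _ i)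
    have hle2 : ∀ i, ‖A₀ ((w i : ℂ) • e i)‖ * ‖A (N (k n)) (e i) - A₀ (e i)‖ ≤
        w i * ‖(A (N (k n)) - A₀) (e i)‖ := fun i => by
      rw [hnw, sub_apply]
      exact mul_le_mul_of_nonneg_right (mul_le_of_le_one_right (hw0 i) (hbd₀ i)) (norm_nonneg _)
    have hs1 := hsd.of_nonneg_of_le (fun i => by positivity) hle1
    have hs2 := hsd.of_nonneg_of_le (fun i => by positivity) hle2
    have hle := tnorm_sub_le_of_slices T e1 e2
      (u := fun i => A (N (k n)) ((w i : ℂ) • e i)) (v := fun i => A (N (k n)) (e i))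
      (u' := fun i => A₀ ((w i : ℂ) • e i)) (v' := fun i => A₀ (e i))
      (hb (N (k n))) hb₀ hs1 hs2
    rw [← hN (k n)] at hle
    exact hle.trans (add_le_add (hs1.tsum_le_tsum hle1 hsd) (hs2.tsum_le_tsum hle2 hsd))

lemma NucRep.conj {σ : H →L[ℂ] H} {f g : τ → H} (h : NucRep σ f g) (A : H →L[ℂ] W) :
    NucRep (A ∘L σ ∘L adjoint A) (fun i => A (f i)) (fun i => A (g i)) := by
  simpa using (h.comp_right (adjoint A)).comp_left A

lemma SOTRelCompact.exists_leftMarginals (T : TensorStruct K1 K2 W) (e1 : HilbertBasis ℕ ℂ K1)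
    (e2 : HilbertBasis ℕ ℂ K2) (eW : HilbertBasis ℕ ℂ W) (e : HilbertBasis ℕ ℂ H)
    {A : ℕ → H →L[ℂ] W} (hA : ∀ n, ‖A n‖ ≤ 1) (h : SOTRelCompact {B | ∃ n, B = A n})
    {w : ℕ → ℝ} {σ : H →L[ℂ] H} (hw0 : ∀ k, 0 ≤ w k) (hw : Summable w)
    (hσ : NucRep σ (fun k => (w k : ℂ) • e k) e) :
    ∃ b : ℕ → K1 →L[ℂ] K1, (∀ n, IsLeftMarginal T e1 eW (A n ∘L σ ∘L adjoint (A n)) (b n)) ∧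
      TNRelCompactIn e1 {ρ | IsPTC ρ} {x | ∃ n, x = b n} := by
  choose b hb using fun n => exists_nucRep (T.summable_slice e1 e2 (hσ.conj (A n)).summable).1
  exact ⟨b, fun n => (hσ.conj (A n)).isLeftMarginal T e1 e2 eW (hb n),
    h.tnRelCompactIn T e1 e2 e hA hw0 hw hb⟩

end Forward

section Backward

set_option linter.unusedSectionVars false

variable {H K K1 K2 W : Type*}
  [NormedAddCommGroup H] [InnerProductSpace ℂ H] [CompleteSpace H]
  [NormedAddCommGroup K] [InnerProductSpace ℂ K] [CompleteSpace K]
  [NormedAddCommGroup K1] [InnerProductSpace ℂ K1] [CompleteSpace K1]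
  [NormedAddCommGroup K2] [InnerProductSpace ℂ K2] [CompleteSpace K2]
  [NormedAddCommGroup W] [InnerProductSpace ℂ W] [CompleteSpace W]
  {ι κ τ : Type*}

/-- The projection onto the orthogonal complement of the first `m` basis vectors. -/
def tailProj (e : HilbertBasis ℕ ℂ K) (m : ℕ) : K →L[ℂ] K :=
  (Submodule.span ℂ (e '' Set.Iio m))ᗮ.starProjection

lemma norm_tailProj_le (e : HilbertBasis ℕ ℂ K) (m : ℕ) : ‖tailProj e m‖ ≤ 1 :=
  Submodule.starProjection_norm_le _

lemma inner_tailProj (e : HilbertBasis ℕ ℂ K) (m i : ℕ) (x : K) :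
    ⟪e i, tailProj e m x⟫ = if m ≤ i then ⟪e i, x⟫ else 0 := by
  rw [tailProj, ← Submodule.inner_starProjection_left_eq_right]
  split_ifs with h
  · rw [Submodule.starProjection_eq_self_iff.2]
    rw [Submodule.mem_orthogonal]
    intro u hu
    induction hu using Submodule.span_induction with
    | mem v hv =>
      obtain ⟨j, hj, rfl⟩ := hv
      exact e.orthonormal.inner_eq_zero (hj.trans_le h).ne
    | zero => simp
    | add a b _ _ ha hb => rw [inner_add_left, ha, hb, add_zero]
    | smul c a _ ha => rw [inner_smul_left, ha, mul_zero]
  · rw [(Submodule.starProjection_apply_eq_zero_iff _).2, inner_zero_left]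
    exact Submodule.le_orthogonal_orthogonal _
      (Submodule.subset_span ⟨i, not_le.1 h, rfl⟩)

lemma trC_tailProj_comp (e : HilbertBasis ℕ ℂ K) (m : ℕ) (C : K →L[ℂ] K) :
    trC e (tailProj e m ∘L C) = ∑' i, if m ≤ i then ⟪e i, C (e i)⟫ else 0 := by
  simp [trC, inner_tailProj]

lemma NucRep.tendsto_trC_tailProj_comp {C : K →L[ℂ] K} {f g : ι → K} (h : NucRep C f g)
    (e : HilbertBasis ℕ ℂ K) :
    Tendsto (fun m => trC e (tailProj e m ∘L C)) atTop (𝓝 0) := by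
  have := tendsto_tsum_of_dominated_convergence (𝓕 := atTop)
    (f := fun m i => if m ≤ i then ⟪e i, C (e i)⟫ else 0) (g := fun _ => (0 : ℂ))
    (h.hasSum_trace e).summable.norm
    (fun i => tendsto_const_nhds.congr' <| by
      filter_upwards [eventually_gt_atTop i] with m hm
      rw [if_neg hm.not_ge])
    (Eventually.of_forall fun m i => by split_ifs <;> simp)
  simpa [trC_tailProj_comp] using this

/-- A trace-norm convergent sequence of trace-class operators has uniformly small tails. -/
lemma TNConv.eventually_tail_lt {e : HilbertBasis ℕ ℂ K} {b : ℕ → K →L[ℂ] K} {L : K →L[ℂ] K}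
    (h : TNConv e b L) {f g : ℕ → ι → K} (hb : ∀ n, NucRep (b n) (f n) (g n)) (hL : IsTC L)
    {ε : ℝ} (hε : 0 < ε) : ∃ m, ∀ᶠ n in atTop, ‖trC e (tailProj e m ∘L b n)‖ < ε := by
  obtain ⟨f', g', hL⟩ := hL.exists_nucRep
  obtain ⟨m, hm⟩ := ((hL.tendsto_trC_tailProj_comp e).norm.eventually_lt_const
    (show ‖(0 : ℂ)‖ < ε / 2 by rw [norm_zero]; exact half_pos hε)).exists
  refine ⟨m, ?_⟩
  filter_upwards [h.eventually_lt_const (half_pos hε)] with n hn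
  have hsub := (hb n).sub hL
  have h1 := hsub.norm_trC_comp_le_tnorm e (norm_tailProj_le e m)
  have h2 : trC e (tailProj e m ∘L b n) =
      trC e (tailProj e m ∘L (b n - L)) + trC e (tailProj e m ∘L L) := by
    rw [← (hsub.comp_left _).trC_add (hL.comp_left _), ← ContinuousLinearMap.comp_add,
      sub_add_cancel]
  rw [h2]
  exact (norm_add_le _ _).trans_lt (by linarith)

lemma ContinuousLinearMap.IsPositive.norm_inner_sq_le {σ : H →L[ℂ] H} (h : σ.IsPositive)
    (z y : H) : ‖⟪z, σ y⟫‖ ^ 2 ≤ ⟪z, σ z⟫.re * ⟪y, σ y⟫.re := by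
  have hsym : ∀ x y, ⟪σ x, y⟫ = ⟪x, σ y⟫ := h.isSelfAdjoint.isSymmetric
  let c : PreInnerProductSpace.Core ℂ H :=
    { inner := fun x y => ⟪x, σ y⟫
      conj_inner_symm := fun x y => by rw [inner_conj_symm, hsym]
      re_inner_nonneg := fun x => h.re_inner_nonneg_right x
      add_left := fun x y z => inner_add_left _ _ _
      smul_left := fun x y r => inner_smul_left _ _ _ }
  have h1 := @InnerProductSpace.Core.inner_mul_inner_self_le ℂ H _ _ _ c z y
  have h2 : ‖⟪y, σ z⟫‖ = ‖⟪z, σ y⟫‖ := by rw [← hsym, norm_inner_symm]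
  calc ‖⟪z, σ y⟫‖ ^ 2 = ‖⟪z, σ y⟫‖ * ‖⟪y, σ z⟫‖ := by rw [h2, sq]
    _ ≤ _ := h1

lemma Summable.ite {E : Type*} [NormedAddCommGroup E] [CompleteSpace E]
    {f : ι → E} (h : Summable f) (P : ι → Prop) [DecidablePred P] :
    Summable fun i => if P i then f i else 0 :=
  (h.indicator {i | P i}).congr fun i => by simp [Set.indicator]

lemma IsLeftMarginal.exists_nucRep {T : TensorStruct K1 K2 W} {e1 : HilbertBasis ι ℂ K1}
    (e2 : HilbertBasis κ ℂ K2) {κ' : Type*} {eW : HilbertBasis κ' ℂ W} {ω : W →L[ℂ] W}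
    {b : K1 →L[ℂ] K1} (h : IsLeftMarginal T e1 eW ω b) {u v : τ → W} (hω : NucRep ω u v) :
    NucRep b (fun p : τ × κ => T.slice (e2 p.2) (u p.1))
      (fun p : τ × κ => T.slice (e2 p.2) (v p.1)) := by
  obtain ⟨b', hb'⟩ := _root_.exists_nucRep (T.summable_slice e1 e2 hω.summable).1
  rwa [h.unique (hω.isLeftMarginal T e1 e2 eW hb')]

lemma IsLeftMarginal.hasSum_tail {T : TensorStruct K1 K2 W} {e1 : HilbertBasis ℕ ℂ K1}
    (e2 : HilbertBasis κ ℂ K2) {κ' : Type*} {eW : HilbertBasis κ' ℂ W} {ω : W →L[ℂ] W}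
    {b : K1 →L[ℂ] K1} (h : IsLeftMarginal T e1 eW ω b) {u v : τ → W} (hω : NucRep ω u v)
    (m : ℕ) :
    HasSum (fun p : ℕ × κ => if m ≤ p.1 then
      ⟪T.basis e1 e2 p, ω (T.basis e1 e2 p)⟫ else 0) (trC e1 (tailProj e1 m ∘L b)) := by
  have hb := h.exists_nucRep e2 hω
  have hdiag : ∀ i, HasSum (fun j => ⟪T.basis e1 e2 (i, j), ω (T.basis e1 e2 (i, j))⟫)
      ⟪e1 i, b (e1 i)⟫ := fun i => by
    refine ((Equiv.prodComm κ τ).hasSum_iff.2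
      ((hb.hasSum (e1 i)).mapL (innerSL ℂ (e1 i)))).prod_fiberwise fun j => ?_
    refine ((hω.hasSum (T.basis e1 e2 (i, j))).mapL
      (innerSL ℂ (T.basis e1 e2 (i, j)))).congr_fun fun k => ?_
    simp [T.inner_slice_left, T.inner_slice_right]
  have hsum : Summable fun p : ℕ × κ => if m ≤ p.1 then
      ⟪T.basis e1 e2 p, ω (T.basis e1 e2 p)⟫ else 0 :=
    (hω.hasSum_trace (T.basis e1 e2)).summable.ite fun p => m ≤ p.1
  have := hsum.hasSum.prod_fiberwise (g := fun i => if m ≤ i then ⟪e1 i, b (e1 i)⟫ else 0)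
    fun i => by
      split_ifs with hi
      · simpa only [hi, if_true] using hdiag i
      · simpa only [hi, if_false] using hasSum_zero
  rw [trC_tailProj_comp, this.tsum_eq]
  exact hsum.hasSum

lemma IsLeftMarginal.tsum_tail_le {T : TensorStruct K1 K2 W} {e1 : HilbertBasis ℕ ℂ K1}
    (e2 : HilbertBasis κ ℂ K2) {κ' : Type*} {eW : HilbertBasis κ' ℂ W} {σ : H →L[ℂ] H}
    (hσ : σ.IsPositive) {f g : τ → H} (hfg : NucRep σ f g) {a : H →L[ℂ] W} {b : K1 →L[ℂ] K1}
    (h : IsLeftMarginal T e1 eW (a ∘L σ ∘L adjoint a) b) (y : H) (m : ℕ) :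
    ∑' p : ℕ × κ, (if m ≤ p.1 then ‖⟪T.mul (e1 p.1) (e2 p.2), a (σ y)⟫‖ ^ 2 else 0) ≤
      ‖trC e1 (tailProj e1 m ∘L b)‖ * ⟪y, σ y⟫.re := by
  have hs := (h.hasSum_tail e2 (hfg.conj a) m).mapL Complex.reCLM
  have hy : 0 ≤ ⟪y, σ y⟫.re := hσ.re_inner_nonneg_right y
  have hle : ∀ p : ℕ × κ, (if m ≤ p.1 then ‖⟪T.mul (e1 p.1) (e2 p.2), a (σ y)⟫‖ ^ 2 else 0) ≤
      Complex.reCLM (if m ≤ p.1 then ⟪T.basis e1 e2 p,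
        (a ∘L σ ∘L adjoint a) (T.basis e1 e2 p)⟫ else 0) * ⟪y, σ y⟫.re := fun p => by
    split_ifs
    · have := hσ.norm_inner_sq_le (adjoint a (T.basis e1 e2 p)) y
      simpa [ContinuousLinearMap.adjoint_inner_left] using this
    · simp
  have h0 : ∀ p : ℕ × κ,
      0 ≤ (if m ≤ p.1 then ‖⟪T.mul (e1 p.1) (e2 p.2), a (σ y)⟫‖ ^ 2 else 0) := fun p => by
    positivity
  refine (((hs.mul_right _).summable.of_nonneg_of_le h0 hle).tsum_le_tsum hle
    (hs.mul_right _).summable).trans ?_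
  rw [(hs.mul_right _).tsum_eq]
  exact mul_le_mul_of_nonneg_right (Complex.re_le_norm _) hy

lemma cauchySeq_of_eventually_dist_lt {E : Type*} [PseudoMetricSpace E] {v : ℕ → E}
    (h : ∀ ε > 0, ∃ w, ∀ᶠ n in atTop, dist (v n) w < ε) : CauchySeq v := by
  refine Metric.cauchySeq_iff.2 fun ε hε => ?_
  obtain ⟨w, hw⟩ := h (ε / 2) (half_pos hε)
  obtain ⟨N, hN⟩ := eventually_atTop.1 hw
  exact ⟨N, fun m hm n hn => by
    linarith [dist_triangle_right (v m) (v n) w, hN m hm, hN n hn]⟩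

lemma HilbertBasis.hasSum_norm_inner_sq (F : HilbertBasis ι ℂ K) (x : K) :
    HasSum (fun i => ‖⟪F i, x⟫‖ ^ 2) (‖x‖ ^ 2) := by
  have h := F.hasSum_inner_mul_inner x x
  have h1 : ∀ i, ⟪x, F i⟫ * ⟪F i, x⟫ = ((‖⟪F i, x⟫‖ ^ 2 : ℝ) : ℂ) := fun i => by
    rw [← inner_conj_symm x (F i), mul_comm, Complex.mul_conj, Complex.normSq_eq_norm_sq]
  rw [inner_self_eq_norm_sq_to_K] at h
  refine Complex.hasSum_ofReal.1 ?_
  push_cast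
  exact h.congr_fun fun i => by rw [h1]; push_cast; rfl

/-- A sequence with convergent coordinates and uniformly small tails is Cauchy. -/
lemma HilbertBasis.cauchySeq_of_coord (F : HilbertBasis ι ℂ K) {v : ℕ → K}
    (h1 : ∀ i, ∃ l, Tendsto (fun n => ⟪F i, v n⟫) atTop (𝓝 l))
    (h2 : ∀ ε > 0, ∃ s : Set ι, s.Finite ∧ ∀ᶠ n in atTop,
      ∑' i, sᶜ.indicator (fun i => ‖⟪F i, v n⟫‖ ^ 2) i < ε) : CauchySeq v := by
  classical
  choose l hl using h1
  refine cauchySeq_of_eventually_dist_lt fun ε hε => ?_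
  obtain ⟨s, hs, htail⟩ := h2 ((ε / 2) ^ 2) (by positivity)
  lift s to Finset ι using hs
  refine ⟨∑ i ∈ s, l i • F i, ?_⟩
  have hlim : Tendsto (fun n => ∑ i ∈ s, ⟪F i, v n⟫ • F i) atTop (𝓝 (∑ i ∈ s, l i • F i)) :=
    tendsto_finsetSum _ fun i _ => (hl i).smul_const _
  filter_upwards [htail, Metric.tendsto_nhds.1 hlim _ (half_pos hε)] with n hn hn'
  have hcoord : ∀ i, ‖⟪F i, v n - ∑ j ∈ s, ⟪F j, v n⟫ • F j⟫‖ ^ 2 =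
      (s : Set ι)ᶜ.indicator (fun i => ‖⟪F i, v n⟫‖ ^ 2) i := fun i => by
    have hsum : ⟪F i, ∑ j ∈ s, ⟪F j, v n⟫ • F j⟫ = if i ∈ s then ⟪F i, v n⟫ else 0 := by
      simp [orthonormal_iff_ite.1 F.orthonormal]
    rw [inner_sub_right, hsum]
    by_cases hi : i ∈ s <;> simp [hi]
  have hnorm := (F.hasSum_norm_inner_sq (v n - ∑ j ∈ s, ⟪F j, v n⟫ • F j)).tsum_eq
  simp only [hcoord] at hnorm
  rw [hnorm] at hn
  have := lt_of_pow_lt_pow_left₀ 2 (half_pos hε).le hn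
  rw [← dist_eq_norm] at this
  linarith [dist_triangle (v n) (∑ j ∈ s, ⟪F j, v n⟫ • F j) (∑ i ∈ s, l i • F i)]

/-- A contractive sequence converging pointwise on a set with dense span converges strongly. -/
lemma exists_SOTConv_of_dense {a : ℕ → H →L[ℂ] W} (ha : ∀ n, ‖a n‖ ≤ 1) {D : Set H}
    (hD : Dense (Submodule.span ℂ D : Set H)) (h : ∀ x ∈ D, CauchySeq fun n => a n x) :
    ∃ A, SOTConv a A := by
  have hspan : ∀ x ∈ Submodule.span ℂ D, ∃ l, Tendsto (fun n => a n x) atTop (𝓝 l) := by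
    intro x hx
    induction hx using Submodule.span_induction with
    | mem v hv => exact cauchySeq_tendsto_of_complete (h v hv)
    | zero => exact ⟨0, by simp⟩
    | add x y _ _ hx hy =>
      obtain ⟨l, hl⟩ := hx
      obtain ⟨l', hl'⟩ := hy
      exact ⟨l + l', by simpa using hl.add hl'⟩
    | smul c x _ hx =>
      obtain ⟨l, hl⟩ := hx
      exact ⟨c • l, by simpa using hl.const_smul c⟩
  have hall : ∀ x, ∃ l, Tendsto (fun n => a n x) atTop (𝓝 l) := fun x => by
    refine cauchySeq_tendsto_of_complete (cauchySeq_of_eventually_dist_lt fun ε hε => ?_)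
    obtain ⟨y, hy, hxy⟩ := hD.exists_dist_lt x (half_pos hε)
    obtain ⟨l, hl⟩ := hspan y hy
    refine ⟨l, ?_⟩
    filter_upwards [Metric.tendsto_nhds.1 hl _ (half_pos hε)] with n hn
    have h1 : dist (a n x) (a n y) ≤ dist x y := by
      rw [dist_eq_norm, dist_eq_norm, ← map_sub]
      exact ((a n).le_of_opNorm_le (ha n) _).trans_eq (one_mul _)
    linarith [dist_triangle (a n x) (a n y) l]
  choose l hl using hall
  exact ⟨continuousLinearMapOfTendsto a (tendsto_pi_nhds.2 hl), hl⟩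

lemma dense_span_range_of_injective (e : HilbertBasis ι ℂ H) {σ : H →L[ℂ] H}
    (h : σ.IsPositive) (hinj : ∀ x, σ x = 0 → x = 0) :
    Dense (Submodule.span ℂ (Set.range fun k => σ (e k)) : Set H) := by
  rw [Submodule.dense_iff_topologicalClosure_eq_top, Submodule.topologicalClosure_eq_top_iff,
    Submodule.eq_bot_iff]
  intro x hx
  have hsym : ∀ x y, ⟪σ x, y⟫ = ⟪x, σ y⟫ := h.isSelfAdjoint.isSymmetric
  refine hinj x (ext_inner_left ℂ fun y => ?_)
  have h0 : ∀ k, ⟪e k, σ x⟫ = 0 := fun k => by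
    rw [← hsym]
    exact hx _ (Submodule.subset_span ⟨k, rfl⟩)
  rw [← e.tsum_inner_mul_inner]
  simp [h0]

lemma exists_subseq_coord {f : ℕ → κ → ℂ} [Countable κ] {R : κ → ℝ} (h : ∀ n k, ‖f n k‖ ≤ R k) :
    ∃ φ : ℕ → ℕ, StrictMono φ ∧ ∀ k, ∃ l, Tendsto (fun n => f (φ n) k) atTop (𝓝 l) := by
  obtain ⟨l, -, φ, hφ, hl⟩ := (isCompact_univ_pi fun k =>
    isCompact_closedBall (0 : ℂ) (R k)).tendsto_subseq (x := f) fun n k _ => by simpa using h n k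
  exact ⟨φ, hφ, fun k => ⟨l k, tendsto_pi_nhds.1 hl k⟩⟩

lemma SOTRelCompact.of_marginals (T : TensorStruct K1 K2 W) (e : HilbertBasis ℕ ℂ H)
    (e1 : HilbertBasis ℕ ℂ K1) (e2 : HilbertBasis ℕ ℂ K2) (eW : HilbertBasis ℕ ℂ W)
    {A : ℕ → H →L[ℂ] W} (hA : ∀ n, ‖A n‖ ≤ 1) {σ : H →L[ℂ] H} (hσ : IsFaithfulState e σ)
    {b : ℕ → K1 →L[ℂ] K1} {c : ℕ → K2 →L[ℂ] K2}
    (hb : ∀ n, IsLeftMarginal T e1 eW (A n ∘L σ ∘L adjoint (A n)) (b n))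
    (hc : ∀ n, IsRightMarginal T e2 eW (A n ∘L σ ∘L adjoint (A n)) (c n))
    (hbc : TNRelCompactIn e1 {ρ | IsPTC ρ} {x | ∃ n, x = b n})
    (hcc : TNRelCompactIn e2 {ρ | IsPTC ρ} {x | ∃ n, x = c n}) :
    SOTRelCompact {B | ∃ n, B = A n} := by
  obtain ⟨⟨hpos, htc, -⟩, hinj⟩ := hσ
  obtain ⟨f, g, hfg⟩ := htc.exists_nucRep
  have hc' := fun n => isLeftMarginal_swap.2 (hc n)
  intro a ha
  choose N hN using ha
  obtain ⟨k₁, L₁, hk₁, hL₁, hconv₁⟩ := hbc (fun n => b (N n)) fun n => ⟨_, rfl⟩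
  obtain ⟨k₂, L₂, hk₂, hL₂, hconv₂⟩ := hcc (fun n => c (N (k₁ n))) fun n => ⟨_, rfl⟩
  have hbound : ∀ n x, ‖A n x‖ ≤ ‖x‖ := fun n x =>
    ((A n).le_of_opNorm_le (hA n) x).trans_eq (one_mul _)
  obtain ⟨k₃, hk₃, hcoord⟩ := exists_subseq_coord
    (f := fun n (q : (ℕ × ℕ) × ℕ) => ⟪T.basis e1 e2 q.1, A (N (k₁ (k₂ n))) (σ (e q.2))⟫)
    (R := fun q => ‖σ (e q.2)‖) fun n q => by
      refine (norm_inner_le_norm _ _).trans ?_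
      rw [(T.basis e1 e2).orthonormal.norm_eq_one, one_mul]
      exact hbound _ _
  set M : ℕ → ℕ := fun n => N (k₁ (k₂ (k₃ n))) with hM
  have hconv₁' : TNConv e1 (fun n => b (M n)) L₁ :=
    (show Tendsto (fun n => tnorm e1 (b (N (k₁ n)) - L₁)) atTop (𝓝 0) from hconv₁).comp
      (hk₂.comp hk₃).tendsto_atTop
  have hconv₂' : TNConv e2 (fun n => c (M n)) L₂ :=
    (show Tendsto (fun n => tnorm e2 (c (N (k₁ (k₂ n))) - L₂)) atTop (𝓝 0) from hconv₂).comp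
      hk₃.tendsto_atTop
  obtain ⟨A₀, hA₀⟩ := exists_SOTConv_of_dense (a := fun n => A (M n)) (fun n => hA _)
    (dense_span_range_of_injective e hpos hinj) <| by
    rintro _ ⟨k, rfl⟩
    refine (T.basis e1 e2).cauchySeq_of_coord (fun p => hcoord (p, k)) fun ε hε => ?_
    have hy : 0 ≤ ⟪e k, σ (e k)⟫.re := hpos.re_inner_nonneg_right _
    set C := ⟪e k, σ (e k)⟫.re + 1 with hC
    obtain ⟨m₁, hm₁⟩ := hconv₁'.eventually_tail_lt
      (fun n => (hb (M n)).exists_nucRep e2 (hfg.conj _)) hL₁.2 (ε := ε / (2 * C)) (by positivity)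
    obtain ⟨m₂, hm₂⟩ := hconv₂'.eventually_tail_lt
      (fun n => (hc' (M n)).exists_nucRep e1 (hfg.conj _)) hL₂.2 (ε := ε / (2 * C)) (by positivity)
    refine ⟨Set.Iio m₁ ×ˢ Set.Iio m₂, (Set.finite_Iio _).prod (Set.finite_Iio _), ?_⟩
    filter_upwards [hm₁, hm₂] with n hn₁ hn₂
    have ht₁ := (hb (M n)).tsum_tail_le e2 hpos hfg (e k) m₁
    have ht₂ := (hc' (M n)).tsum_tail_le e1 hpos hfg (e k) m₂
    rw [← (Equiv.prodComm ℕ ℕ).tsum_eq] at ht₂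
    simp only [Equiv.prodComm_apply, Prod.fst_swap, Prod.snd_swap, T.swap_mul] at ht₂
    have hsum := ((T.basis e1 e2).hasSum_norm_inner_sq (A (M n) (σ (e k)))).summable
    simp only [T.basis_apply] at hsum ⊢
    have hs₁ := hsum.ite fun p => m₁ ≤ p.1
    have hs₂ := hsum.ite fun p => m₂ ≤ p.2
    have hle : ∀ p : ℕ × ℕ, (Set.Iio m₁ ×ˢ Set.Iio m₂)ᶜ.indicator
        (fun p : ℕ × ℕ => ‖⟪T.mul (e1 p.1) (e2 p.2), A (M n) (σ (e k))⟫‖ ^ 2) p ≤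
        (if m₁ ≤ p.1 then ‖⟪T.mul (e1 p.1) (e2 p.2), A (M n) (σ (e k))⟫‖ ^ 2 else 0) +
        (if m₂ ≤ p.2 then ‖⟪T.mul (e1 p.1) (e2 p.2), A (M n) (σ (e k))⟫‖ ^ 2 else 0) := by
      intro p
      by_cases h1 : m₁ ≤ p.1 <;> by_cases h2 : m₂ ≤ p.2 <;>
        simp [Set.indicator, h1, h2, ← not_le]
    have h1 := ((hsum.indicator _).tsum_le_tsum hle (hs₁.add hs₂)).trans_eq (hs₁.tsum_add hs₂)
    refine (h1.trans (add_le_add ht₁ ht₂)).trans_lt ?_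
    rw [lt_div_iff₀ (by positivity)] at hn₁ hn₂
    nlinarith [norm_nonneg (trC e1 (tailProj e1 m₁ ∘L b (M n))),
      norm_nonneg (trC e2 (tailProj e2 m₂ ∘L c (M n)))]
  exact ⟨k₁ ∘ k₂ ∘ k₃, A₀, hk₁.comp (hk₂.comp hk₃), by simp only [hN]; exact hA₀⟩

end Backward

section Statement

variable {H K1 K2 W : Type*}
  [NormedAddCommGroup H] [InnerProductSpace ℂ H] [CompleteSpace H]
  [NormedAddCommGroup K1] [InnerProductSpace ℂ K1] [CompleteSpace K1]
  [NormedAddCommGroup K2] [InnerProductSpace ℂ K2] [CompleteSpace K2]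
  [NormedAddCommGroup W] [InnerProductSpace ℂ W] [CompleteSpace W]

/-- A sequence `{A_n}` in the unit ball of `B(H, K₁⊗K₂)` is relatively compact in the strong
operator topology iff for some faithful state `σ` both sequences of partial traces
`{Tr_{K₂}(A_n σ A_n*)}` and `{Tr_{K₁}(A_n σ A_n*)}` are relatively compact in trace norm. -/
theorem SOT_relative_compactness_via_marginals
    (eH : HilbertBasis ℕ ℂ H) (e1 : HilbertBasis ℕ ℂ K1) (e2 : HilbertBasis ℕ ℂ K2)
    (eW : HilbertBasis ℕ ℂ W) (T : TensorStruct K1 K2 W)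
    (A : ℕ → H →L[ℂ] W) (hA : ∀ n, ‖A n‖ ≤ 1) :
    SOTRelCompact {B | ∃ n, B = A n} ↔
      ∃ σ : H →L[ℂ] H, IsFaithfulState eH σ ∧
        ∃ (b : ℕ → K1 →L[ℂ] K1) (c : ℕ → K2 →L[ℂ] K2),
          (∀ n, IsLeftMarginal T e1 eW
            (A n ∘L σ ∘L ContinuousLinearMap.adjoint (A n)) (b n)) ∧
          (∀ n, IsRightMarginal T e2 eW
            (A n ∘L σ ∘L ContinuousLinearMap.adjoint (A n)) (c n)) ∧
          TNRelCompactIn e1 {ρ | IsPTC ρ} {x | ∃ n, x = b n} ∧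
          TNRelCompactIn e2 {ρ | IsPTC ρ} {x | ∃ n, x = c n} := by
  constructor
  · intro h
    obtain ⟨w, σ, hw0, hw, hσ, hfaith⟩ := exists_isFaithfulState eH
    obtain ⟨b, hb, hbc⟩ := h.exists_leftMarginals T e1 e2 eW eH hA hw0 hw hσ
    obtain ⟨c, hc, hcc⟩ := h.exists_leftMarginals T.swap e2 e1 eW eH hA hw0 hw hσ
    exact ⟨σ, hfaith, b, c, hb, fun n => isLeftMarginal_swap.1 (hc n), hbc, hcc⟩
  · rintro ⟨σ, hσ, b, c, hb, hc, hbc, hcc⟩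
    exact SOTRelCompact.of_marginals T eH e1 e2 eW hA hσ hb hc hbc hcc

end Statement
end
end

section
/- Let {P_m} be an increasing sequence of finite-rank projections on a separable Hilbert space H converging strongly to the identity I_H, write P̄_m = I_H − P_m, and let {α_m} be a sequence of nonnegative reals converging to 0. Then the set B_{P_m,α_m} = { A ∈ B(H) : ‖A‖ ≤ 1 and ‖P̄_m A − A P̄_m‖ ≤ α_m for all m } is compact in the strong operator topology. -/
open Filter Topology ContinuousLinearMap
open scoped ComplexOrder

noncomputable section

section Statement

variable {H : Type*} [NormedAddCommGroup H] [InnerProductSpace ℂ H] [CompleteSpace H]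

omit [CompleteSpace H] in
/-- A set that is approximated up to every `ε` by its image, under a finite-rank operator, is totally
bounded as soon as it is bounded. -/
theorem totallyBounded_of_finiteRank_approx {S : Set H} (hS : Bornology.IsBounded S)
    (hP : ∀ ε > 0, ∃ P : H →L[ℂ] H,
      FiniteDimensional ℂ (LinearMap.range (P : H →ₗ[ℂ] H)) ∧ ∀ y ∈ S, ‖y - P y‖ < ε) :
    TotallyBounded S := by
  refine Metric.totallyBounded_iff.2 fun ε hε => ?_
  obtain ⟨P, hfin, hP⟩ := hP (ε / 2) (half_pos hε)
  let V := LinearMap.range (P : H →ₗ[ℂ] H)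
  let Q : H →L[ℂ] V := P.codRestrict V fun x => ⟨x, rfl⟩
  have hV : ProperSpace V := FiniteDimensional.proper ℂ V
  have hQ : TotallyBounded (Q '' S) :=
    (Q.lipschitz.isBounded_image hS).isCompact_closure.totallyBounded.subset subset_closure
  have hPS : TotallyBounded (P '' S) := by
    have h := hQ.image (uniformContinuous_subtype_val (p := fun x => x ∈ V))
    rwa [Set.image_image] at h
  obtain ⟨t, ht, hcov⟩ := Metric.totallyBounded_iff.1 hPS (ε / 2) (half_pos hε)
  refine ⟨t, ht, fun y hy => ?_⟩
  obtain ⟨z, hz, hyz⟩ := Set.mem_iUnion₂.1 (hcov ⟨y, hy, rfl⟩)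
  refine Set.mem_iUnion₂.2 ⟨z, hz, ?_⟩
  have h1 := hP y hy
  rw [← dist_eq_norm] at h1
  rw [Metric.mem_ball] at hyz ⊢
  linarith [dist_triangle y (P y) z]

omit [CompleteSpace H] in
/-- A Hilbert space in which finite-rank operators converge strongly to the identity is separable. -/
theorem separableSpace_of_tendsto_finiteRank {P : ℕ → H →L[ℂ] H}
    (hP : ∀ m, FiniteDimensional ℂ (LinearMap.range (P m : H →ₗ[ℂ] H)))
    (hto1 : ∀ x : H, Tendsto (fun m => P m x) atTop (nhds x)) :
    TopologicalSpace.SeparableSpace H := by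
  have hsep : TopologicalSpace.IsSeparable
      (⋃ m, (LinearMap.range (P m : H →ₗ[ℂ] H) : Set H)) := by
    refine TopologicalSpace.IsSeparable.iUnion fun m => ?_
    have := FiniteDimensional.proper ℂ (LinearMap.range (P m : H →ₗ[ℂ] H))
    exact TopologicalSpace.IsSeparable.of_subtype
      (LinearMap.range (P m : H →ₗ[ℂ] H) : Set H)
  refine TopologicalSpace.isSeparable_univ_iff.1 (hsep.closure.mono fun x _ => ?_)
  exact mem_closure_of_tendsto (hto1 x)
    (Eventually.of_forall fun m => Set.mem_iUnion.2 ⟨m, x, rfl⟩)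

omit [CompleteSpace H] in
/-- A sequence of contractions that converges pointwise on a dense set is pointwise Cauchy. -/
theorem cauchySeq_apply_of_dense {a : ℕ → H →L[ℂ] H} (ha : ∀ n, ‖a n‖ ≤ 1) {D : Set H}
    (hD : Dense D) (hcau : ∀ d ∈ D, CauchySeq fun n => a n d) (x : H) :
    CauchySeq fun n => a n x := by
  refine Metric.cauchySeq_iff.2 fun ε hε => ?_
  obtain ⟨d, hd, hxd⟩ := hD.exists_dist_lt x (ε := ε / 3) (by positivity)
  obtain ⟨N, hN⟩ := Metric.cauchySeq_iff.1 (hcau d hd) (ε / 3) (by positivity)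
  have hclose : ∀ n, dist (a n x) (a n d) < ε / 3 := fun n => by
    rw [dist_eq_norm, ← map_sub]
    rw [dist_eq_norm] at hxd
    exact ((a n).le_of_opNorm_le (ha n) _).trans_lt (by simpa using hxd)
  refine ⟨N, fun m hm n hn => ?_⟩
  have h1 := hclose m
  have h2 := hclose n
  rw [dist_comm] at h2
  linarith [hN m hm n hn, dist_triangle4 (a m x) (a m d) (a n d) (a n x)]

/-- A sequence of contractions with totally bounded orbits on a separable space has a subsequence
that converges in the strong operator topology. -/
theorem exists_subseq_SOTConv [TopologicalSpace.SeparableSpace H] {a : ℕ → H →L[ℂ] H}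
    (ha : ∀ n, ‖a n‖ ≤ 1) (htb : ∀ x, TotallyBounded (Set.range fun n => a n x)) :
    ∃ (k : ℕ → ℕ) (A : H →L[ℂ] H), StrictMono k ∧ SOTConv (fun n => a (k n)) A := by
  let d := TopologicalSpace.denseSeq H
  have hcomp : IsCompact (Set.univ.pi fun i => closure (Set.range fun n => a n (d i))) :=
    isCompact_univ_pi fun i => (htb (d i)).closure.isCompact_of_isClosed isClosed_closure
  obtain ⟨L, -, k, hk, hL⟩ := hcomp.tendsto_subseq (x := fun n i => a n (d i))
    fun n i _ => subset_closure ⟨n, rfl⟩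
  rw [tendsto_pi_nhds] at hL
  have hcau : ∀ x, CauchySeq fun n => a (k n) x :=
    cauchySeq_apply_of_dense (fun n => ha (k n)) (TopologicalSpace.denseRange_denseSeq H) <| by
      rintro _ ⟨i, rfl⟩
      exact (hL i).cauchySeq
  choose f hf using fun x => cauchySeq_tendsto_of_complete (hcau x)
  exact ⟨k, continuousLinearMapOfTendsto (fun n => a (k n)) (tendsto_pi_nhds.2 hf), hk, hf⟩

omit [CompleteSpace H] in
/-- Norm bounds pass to limits in the strong operator topology. -/
theorem SOTConv.norm_le {a : ℕ → H →L[ℂ] H} {A : H →L[ℂ] H} (h : SOTConv a A) {c : ℝ}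
    (hc : 0 ≤ c) (ha : ∀ n, ‖a n‖ ≤ c) : ‖A‖ ≤ c :=
  A.opNorm_le_bound hc fun x =>
    le_of_tendsto (h x).norm (Eventually.of_forall fun n => (a n).le_of_opNorm_le (ha n) x)

/-- If `{P_m}` is an increasing sequence of finite-rank projections converging strongly to the
identity and `α_m → 0`, then the set of contractions `A` with
`‖(I−P_m)A − A(I−P_m)‖ ≤ α_m` for all `m` is compact in the strong operator topology. -/
theorem almost_commuting_contractions_SOT_compact
    (P : ℕ → H →L[ℂ] H) (hP : ∀ m, IsFinRankProj (P m))
    (hmono : ∀ m, P (m + 1) ∘L P m = P m)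
    (hto1 : ∀ x : H, Tendsto (fun m => P m x) atTop (nhds x))
    (α : ℕ → ℝ) (hα0 : ∀ m, 0 ≤ α m) (hα : Tendsto α atTop (nhds 0)) :
    SOTSeqCompact {A : H →L[ℂ] H | ‖A‖ ≤ 1 ∧
      ∀ m, ‖((1 : H →L[ℂ] H) - P m) ∘L A - A ∘L ((1 : H →L[ℂ] H) - P m)‖ ≤ α m} := by
  intro a ha
  have := separableSpace_of_tendsto_finiteRank (fun m => (hP m).2.2) hto1
  have htb : ∀ x, TotallyBounded (Set.range fun n => a n x) := by
    intro x
    refine totallyBounded_of_finiteRank_approx ?_ fun ε hε => ?_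
    · refine isBounded_iff_forall_norm_le.2 ⟨1 * ‖x‖, ?_⟩
      rintro _ ⟨n, rfl⟩
      exact (a n).le_of_opNorm_le (ha n).1 x
    · have hlim : Tendsto (fun m => α m * ‖x‖ + ‖x - P m x‖) atTop (nhds 0) := by
        simpa using (hα.mul_const ‖x‖).add ((tendsto_const_nhds (x := x)).sub (hto1 x)).norm
      obtain ⟨m, hm⟩ := (hlim.eventually_lt_const hε).exists
      refine ⟨P m, (hP m).2.2, ?_⟩
      rintro _ ⟨n, rfl⟩
      have h1 := ContinuousLinearMap.le_of_opNorm_le _ ((ha n).2 m) x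
      have h2 := (a n).le_of_opNorm_le (ha n).1 (x - P m x)
      have h3 : a n x - P m (a n x) =
          (((1 : H →L[ℂ] H) - P m) ∘L a n - a n ∘L ((1 : H →L[ℂ] H) - P m)) x
            + a n (x - P m x) := by
        simp
      change ‖a n x - P m (a n x)‖ < ε
      rw [h3]
      exact (norm_add_le _ _).trans_lt (by linarith)
  obtain ⟨k, A, hk, hA⟩ := exists_subseq_SOTConv (fun n => (ha n).1) htb
  refine ⟨k, A, hk, ⟨hA.norm_le zero_le_one fun n => (ha (k n)).1, fun m => ?_⟩, hA⟩
  refine SOTConv.norm_le (a := fun n => ((1 : H →L[ℂ] H) - P m) ∘L a (k n)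
    - a (k n) ∘L ((1 : H →L[ℂ] H) - P m)) (fun x => ?_) (hα0 m) fun n => (ha (k n)).2 m
  exact ((((1 : H →L[ℂ] H) - P m).continuous.tendsto _).comp (hA x)).sub (hA _)

end Statement
end
end
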